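/- (Conditional mean of a Gaussian vector.) Let P, M ≥ 1, let A be a symmetric positive definite real P×P matrix, C a symmetric real M×M matrix and B a real M×P matrix such that the (P+M)×(P+M) block matrix [[A, Bᵀ],[B, C]] is symmetric positive semidefinite. Let (Y, F) be an ℝ^P × ℝ^M-valued random vector whose joint law is the multivariate Gaussian measure on ℝ^{P+M} with mean 0 and covariance [[A, Bᵀ],[B, C]]. Then, for each component j ∈ {1,…,M}, the conditional expectation of F_j given the σ-algebra generated by Y equals (B A⁻¹ Y)_j almost surely. -/

import Mathlib

open MeasureTheory Real Matrix

/-- The multivariate Gaussian probability measure on `ι → ℝ` with mean `μ` and covariance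
matrix `S`: for `S` symmetric positive definite, its density with respect to the Lebesgue
measure is `z ↦ (2π)^(-n/2) det(S)^(-1/2) exp(-(1/2)(z-μ)ᵀ S⁻¹ (z-μ))`. -/
noncomputable def mvGaussian {ι : Type*} [Fintype ι] [DecidableEq ι]
    (μ : ι → ℝ) (S : Matrix ι ι ℝ) : Measure (ι → ℝ) :=
  (volume : Measure (ι → ℝ)).withDensity fun z =>
    ENNReal.ofReal ((2 * π) ^ (-(Fintype.card ι : ℝ) / 2) * S.det ^ (-(1 : ℝ) / 2) *
      Real.exp (-(1 / 2) * ((z - μ) ⬝ᵥ S⁻¹.mulVec (z - μ))))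


lemma aux_coercive {ι : Type*} [Fintype ι] (M : Matrix ι ι ℝ) (hM : M.PosDef) :
    ∃ c : ℝ, 0 < c ∧ ∀ z : ι → ℝ, c * ∑ i, z i ^ 2 ≤ z ⬝ᵥ M.mulVec z := by
  have hcont : Continuous fun z : ι → ℝ => z ⬝ᵥ M.mulVec z := by
    unfold Matrix.mulVec dotProduct; fun_prop
  have hkey : ∃ c : ℝ, 0 < c ∧ ∀ z ∈ Metric.sphere (0 : ι → ℝ) 1, c ≤ z ⬝ᵥ M.mulVec z := by
    rcases (Metric.sphere (0 : ι → ℝ) 1).eq_empty_or_nonempty with h | h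
    · exact ⟨1, one_pos, by simp [h]⟩
    · obtain ⟨u, hu, hmin⟩ := (isCompact_sphere (0 : ι → ℝ) 1).exists_isMinOn h hcont.continuousOn
      refine ⟨u ⬝ᵥ M.mulVec u, ?_, fun z hz => hmin hz⟩
      have hu0 : u ≠ 0 := by
        rintro rfl
        simp at hu
      simpa using hM.dotProduct_mulVec_pos hu0
  obtain ⟨c, hc, h⟩ := hkey
  have hn : (0 : ℝ) < Fintype.card ι + 1 := by positivity
  refine ⟨c / (Fintype.card ι + 1), by positivity, fun z => ?_⟩
  by_cases hz : z = 0
  · simp [hz]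
  have hz' : 0 < ‖z‖ := norm_pos_iff.mpr hz
  have h1 := h (‖z‖⁻¹ • z) (by simp [norm_smul, hz'.ne'])
  rw [Matrix.mulVec_smul, smul_dotProduct, dotProduct_smul, smul_eq_mul, smul_eq_mul] at h1
  have h2 : c * ‖z‖ ^ 2 ≤ z ⬝ᵥ M.mulVec z := by
    have := mul_le_mul_of_nonneg_right h1 (sq_nonneg ‖z‖)
    refine this.trans (le_of_eq ?_)
    field_simp
  have h3 : ∑ i, z i ^ 2 ≤ (Fintype.card ι + 1) * ‖z‖ ^ 2 := by
    calc ∑ i, z i ^ 2 ≤ ∑ _i : ι, ‖z‖ ^ 2 := by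
          refine Finset.sum_le_sum fun i _ => ?_
          have := norm_le_pi_norm z i
          rw [Real.norm_eq_abs] at this
          exact sq_le_sq' (by linarith [neg_abs_le (z i)]) (by linarith [le_abs_self (z i)])
      _ = Fintype.card ι * ‖z‖ ^ 2 := by simp
      _ ≤ _ := by nlinarith [sq_nonneg ‖z‖]
  calc c / (Fintype.card ι + 1) * ∑ i, z i ^ 2
      ≤ c / (Fintype.card ι + 1) * ((Fintype.card ι + 1) * ‖z‖ ^ 2) := by gcongr
    _ = c * ‖z‖ ^ 2 := by field_simp
    _ ≤ _ := h2

lemma aux_density_measurable {ι : Type*} [Fintype ι] [DecidableEq ι] (S : Matrix ι ι ℝ) :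
    Measurable fun z : ι → ℝ =>
    ENNReal.ofReal ((2 * π) ^ (-(Fintype.card ι : ℝ) / 2) * S.det ^ (-(1 : ℝ) / 2) *
      Real.exp (-(1 / 2) * ((z - 0) ⬝ᵥ S⁻¹.mulVec (z - 0)))) := by
  refine ENNReal.measurable_ofReal.comp (Continuous.measurable ?_)
  unfold Matrix.mulVec dotProduct; fun_prop

lemma aux_integrable {ι : Type*} [Fintype ι] [DecidableEq ι] (S : Matrix ι ι ℝ) (hS : S.PosDef)
    (k : ι) : Integrable (fun z : ι → ℝ => z k) (mvGaussian 0 S) := by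
  obtain ⟨c, hc, h⟩ := aux_coercive S⁻¹ hS.inv
  unfold mvGaussian
  rw [integrable_withDensity_iff (aux_density_measurable S) (by simp)]
  have hI : Integrable (fun z : ι → ℝ =>
      ∏ i, (if i = k then (fun x : ℝ => x * Real.exp (-(c / 2) * x ^ 2))
        else fun x : ℝ => Real.exp (-(c / 2) * x ^ 2)) (z i)) := by
    refine Integrable.fintype_prod (fun i => ?_)
    split_ifs
    · exact integrable_mul_exp_neg_mul_sq (by positivity)
    · exact integrable_exp_neg_mul_sq (by positivity)
  have hEq : ∀ z : ι → ℝ,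
      ∏ i, (if i = k then (fun x : ℝ => x * Real.exp (-(c / 2) * x ^ 2))
        else fun x : ℝ => Real.exp (-(c / 2) * x ^ 2)) (z i)
      = z k * Real.exp (-(c / 2) * ∑ i, z i ^ 2) := by
    intro z
    rw [Finset.mul_sum, Real.exp_sum]
    have : ∀ i, (if i = k then (fun x : ℝ => x * Real.exp (-(c / 2) * x ^ 2))
        else fun x : ℝ => Real.exp (-(c / 2) * x ^ 2)) (z i)
        = (if i = k then z k else 1) * Real.exp (-(c / 2) * z i ^ 2) := by
      intro i
      split_ifs with hi
      · rw [hi]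
      · simp
    rw [Finset.prod_congr rfl fun i _ => this i, Finset.prod_mul_distrib]
    simp
  simp only [hEq] at hI
  set K : ℝ := (2 * π) ^ (-(Fintype.card ι : ℝ) / 2) * S.det ^ (-(1 : ℝ) / 2) with hK
  have hK0 : 0 ≤ K := by
    have := hS.det_pos
    positivity
  refine (hI.const_mul K).mono ?_ (Filter.Eventually.of_forall fun z => ?_)
  · exact ((measurable_pi_apply k).mul
      (aux_density_measurable S).ennreal_toReal).aestronglyMeasurable
  · rw [ENNReal.toReal_ofReal (by positivity)]
    simp only [norm_mul, Real.norm_eq_abs, Real.abs_exp, abs_of_nonneg hK0, sub_zero]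
    have h1 : Real.exp (-(1 / 2) * (z ⬝ᵥ S⁻¹.mulVec z)) ≤
        Real.exp (-(c / 2) * ∑ i, z i ^ 2) := by
      apply Real.exp_le_exp.mpr
      linarith [h z]
    calc |z k| * (K * Real.exp (-(1 / 2) * (z ⬝ᵥ S⁻¹.mulVec z)))
        = K * (|z k| * Real.exp (-(1 / 2) * (z ⬝ᵥ S⁻¹.mulVec z))) := by ring
      _ ≤ _ := by gcongr

lemma aux_map {ι : Type*} [Fintype ι] [DecidableEq ι] (S T : Matrix ι ι ℝ)
    (hTT : T * T = 1) (hT : T * S * Tᵀ = S) :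
    Measure.map (fun z => T.mulVec z) (mvGaussian 0 S) = mvGaussian 0 S := by
  have hdet : T.det * T.det = 1 := by rw [← Matrix.det_mul, hTT, Matrix.det_one]
  have hdet0 : T.det ≠ 0 := fun h => by simp [h] at hdet
  have habs : |T.det⁻¹| = 1 := by
    rcases mul_self_eq_one_iff.mp hdet with h | h <;> simp [h]
  have hmeas : Measurable fun z : ι → ℝ => T.mulVec z := by
    refine Continuous.measurable ?_
    unfold Matrix.mulVec dotProduct; fun_prop
  have hvol : MeasurePreserving (fun z : ι → ℝ => T.mulVec z) volume volume := by
    refine ⟨hmeas, ?_⟩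
    have := Real.map_matrix_volume_pi_eq_smul_volume_pi hdet0
    rw [habs] at this
    rw [ENNReal.ofReal_one, one_smul] at this
    exact this
  have hTi : T⁻¹ = T := Matrix.inv_eq_left_inv hTT
  have hTti : Tᵀ⁻¹ = Tᵀ := by rw [← Matrix.transpose_nonsing_inv, hTi]
  have hinv : Tᵀ * S⁻¹ * T = S⁻¹ := by
    have := congrArg (fun X => X⁻¹) hT
    simp only [Matrix.mul_inv_rev, hTi, hTti] at this
    rw [Matrix.mul_assoc]; exact this
  have hq : ∀ z : ι → ℝ, T.mulVec z ⬝ᵥ S⁻¹.mulVec (T.mulVec z) = z ⬝ᵥ S⁻¹.mulVec z := by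
    intro z
    conv_rhs => rw [← hinv]
    rw [← Matrix.mulVec_mulVec, ← Matrix.mulVec_mulVec, Matrix.dotProduct_mulVec z Tᵀ,
      Matrix.vecMul_transpose]
  ext s hs
  rw [Measure.map_apply hmeas hs]
  unfold mvGaussian
  rw [withDensity_apply _ hs, withDensity_apply _ (hmeas hs),
    ← hvol.setLIntegral_comp_preimage hs (aux_density_measurable S)]
  simp only [sub_zero, hq]

/-- Conditional mean of a Gaussian vector: if `(Y, F)` is jointly centered Gaussian
with covariance `[[A, Bᵀ],[B, C]]` (`A` positive definite), then for each component `j`,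
`E[F_j | σ(Y)] = (B A⁻¹ Y)_j` almost surely. This is the Gaussian Process Regression
prediction formula. -/
theorem gaussian_conditional_mean
    {Ω : Type*} {mΩ : MeasurableSpace Ω} (P : Measure Ω) [IsProbabilityMeasure P]
    (p m : ℕ) (hp : 1 ≤ p) (hm : 1 ≤ m)
    (A : Matrix (Fin p) (Fin p) ℝ) (hA : A.PosDef)
    (C : Matrix (Fin m) (Fin m) ℝ) (hC : C.IsSymm)
    (B : Matrix (Fin m) (Fin p) ℝ)
    (hBlk : (Matrix.fromBlocks A Bᵀ B C).PosSemidef)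
    (W : Ω → (Fin p ⊕ Fin m) → ℝ) (hW : Measurable W)
    (hlaw : Measure.map W P = mvGaussian 0 (Matrix.fromBlocks A Bᵀ B C)) :
    ∀ j : Fin m,
      (P[fun ω => W ω (Sum.inr j) |
          MeasurableSpace.comap (fun ω (i : Fin p) => W ω (Sum.inl i)) inferInstance])
      =ᵐ[P] fun ω => B.mulVec (A⁻¹.mulVec fun i => W ω (Sum.inl i)) j := by
  classical
  intro j
  set S := Matrix.fromBlocks A Bᵀ B C with hSdef
  have hdet : S.det ≠ 0 := by
    intro h0
    have h1 : (Measure.map W P) Set.univ = 1 := by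
      rw [Measure.map_apply hW MeasurableSet.univ]; simp
    rw [hlaw, mvGaussian, h0, Real.zero_rpow (by norm_num)] at h1
    simp at h1
  have hS : S.PosDef := hBlk.posDef_iff_det_ne_zero.mpr hdet
  have hAdet : IsUnit A.det := (hA.det_pos.ne').isUnit
  have hAsymm : Aᵀ = A := by simpa using hA.1.eq
  have hAiT : A⁻¹ᵀ = A⁻¹ := by rw [Matrix.transpose_nonsing_inv, hAsymm]
  set T : Matrix (Fin p ⊕ Fin m) (Fin p ⊕ Fin m) ℝ :=
    Matrix.fromBlocks 1 0 ((2 : ℝ) • (B * A⁻¹)) (-1) with hTdef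
  have hTT : T * T = 1 := by
    rw [hTdef, Matrix.fromBlocks_multiply, ← Matrix.fromBlocks_one]
    congr 1 <;> simp
  have hTS : T * S * Tᵀ = S := by
    rw [hTdef, hSdef, Matrix.fromBlocks_transpose, Matrix.fromBlocks_multiply,
      Matrix.fromBlocks_multiply]
    have e1 : B * A⁻¹ * A = B := by
      rw [Matrix.mul_assoc, Matrix.nonsing_inv_mul _ hAdet, Matrix.mul_one]
    have e2 : A * (A⁻¹ * Bᵀ) = Bᵀ := by
      rw [← Matrix.mul_assoc, Matrix.mul_nonsing_inv _ hAdet, Matrix.one_mul]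
    congr 1
    · simp
    · simp [hAiT, e2, two_smul, Matrix.mul_add]
    · simp [e1, two_smul, Matrix.add_mul]
    · simp [hAiT, e1, two_smul, Matrix.mul_assoc, Matrix.add_mul, Matrix.mul_add]
      abel
  have hmap := aux_map S T hTT hTS
  have hTl : ∀ z : Fin p ⊕ Fin m → ℝ, (fun i => T.mulVec z (Sum.inl i)) =
      fun i => z (Sum.inl i) := by
    intro z
    ext i
    simp [hTdef, Matrix.fromBlocks_mulVec, Function.comp_def]
  have hTr : ∀ z : Fin p ⊕ Fin m → ℝ, T.mulVec z (Sum.inr j) =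
      2 * B.mulVec (A⁻¹.mulVec fun i => z (Sum.inl i)) j - z (Sum.inr j) := by
    intro z
    simp [hTdef, Matrix.fromBlocks_mulVec, Function.comp_def, Matrix.smul_mulVec,
      Matrix.neg_mulVec, sub_eq_add_neg]
  have hYm : Measurable fun (z : Fin p ⊕ Fin m → ℝ) (i : Fin p) => z (Sum.inl i) := by fun_prop
  have hYW : Measurable fun ω (i : Fin p) => W ω (Sum.inl i) := hYm.comp hW
  have hgc : Continuous fun y : Fin p → ℝ => B.mulVec (A⁻¹.mulVec y) j := by
    unfold Matrix.mulVec dotProduct; fun_prop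
  have hTm : Measurable fun z : Fin p ⊕ Fin m → ℝ => T.mulVec z := by
    refine Continuous.measurable ?_
    unfold Matrix.mulVec dotProduct; fun_prop
  have hint : ∀ k, Integrable (fun z : Fin p ⊕ Fin m → ℝ => z k) (mvGaussian 0 S) :=
    aux_integrable S hS
  have hintG : Integrable (fun z : Fin p ⊕ Fin m → ℝ =>
      B.mulVec (A⁻¹.mulVec fun i => z (Sum.inl i)) j) (mvGaussian 0 S) := by
    unfold Matrix.mulVec dotProduct
    exact integrable_finsetSum _ fun i _ => (integrable_finsetSum _ fun l _ =>
      (hint (Sum.inl l)).const_mul _).const_mul _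
  have hF : Integrable (fun ω => W ω (Sum.inr j)) P := by
    have := hint (Sum.inr j)
    rw [← hlaw] at this
    exact this.comp_measurable hW
  have hG : Integrable (fun ω => B.mulVec (A⁻¹.mulVec fun i => W ω (Sum.inl i)) j) P := by
    have := hintG
    rw [← hlaw] at this
    exact this.comp_measurable hW
  refine (ae_eq_condExp_of_forall_setIntegral_eq hYW.comap_le hF
    (fun s _ _ => hG.integrableOn) ?_ ?_).symm
  · rintro s ⟨t, ht, rfl⟩ -
    set s' : Set (Fin p ⊕ Fin m → ℝ) := (fun z (i : Fin p) => z (Sum.inl i)) ⁻¹' t with hs'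
    have hs'm : MeasurableSet s' := hYm ht
    have tr : ∀ f : (Fin p ⊕ Fin m → ℝ) → ℝ, Measurable f →
        ∫ ω in (fun ω (i : Fin p) => W ω (Sum.inl i)) ⁻¹' t, f (W ω) ∂P =
        ∫ z in s', f z ∂(mvGaussian 0 S) := by
      intro f hf
      rw [← hlaw, setIntegral_map hs'm hf.aestronglyMeasurable hW.aemeasurable]
      rfl
    have hrefl : ∫ z in s', z (Sum.inr j) ∂(mvGaussian 0 S) =
        ∫ z in s', (2 * B.mulVec (A⁻¹.mulVec fun i => z (Sum.inl i)) j - z (Sum.inr j))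
          ∂(mvGaussian 0 S) := by
      conv_lhs => rw [← hmap]
      rw [setIntegral_map hs'm (measurable_pi_apply _).aestronglyMeasurable hTm.aemeasurable]
      have : (fun z : Fin p ⊕ Fin m → ℝ => T.mulVec z) ⁻¹' s' = s' := by
        ext z
        simp only [hs', Set.mem_preimage, hTl]
      rw [this]
      simp only [hTr]
    rw [integral_sub (hintG.const_mul 2).integrableOn (hint _).integrableOn,
      integral_const_mul] at hrefl
    rw [tr (fun z => B.mulVec (A⁻¹.mulVec fun i => z (Sum.inl i)) j)
        (hgc.measurable.comp hYm), tr (fun z => z (Sum.inr j)) (measurable_pi_apply _)]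
    linarith
  · exact (hgc.measurable.comp (comap_measurable _)).stronglyMeasurable.aestronglyMeasurable
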